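/- arXiv:1906.09073 — 10 statements merged into one kernel-verified Lean document; each statement's English description precedes it below -/
import Mathlib

section
/- Let G be a dynamic graph over a finite nonempty set V, with a self-loop at every node in every round. Then the integral Ḡ of G eventually stabilizes to its limit superior: there exists a round s ≥ 1 such that for every t ≥ s, the digraph Ḡ(t) equals the limit superior Ḡ(∞) of the dynamic graph Ḡ (the digraph whose edges are the pairs that are edges of Ḡ(t) for infinitely many t). -/
open scoped Classical

section DynamicGraphs

variable {V : Type*}

/-- The product digraph `G(t:t')`: edge `(u,v)` iff there is a path
`w_t = u, …, w_{t'+1} = v` with `(w_k, w_{k+1})` an edge of `G(k)` for `t ≤ k ≤ t'`.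
For `t' < t` it is the digraph with exactly a self-loop at each node. -/
def DProd (G : ℕ → V → V → Prop) (t t' : ℕ) (u v : V) : Prop :=
  if t' < t then u = v
  else ∃ w : ℕ → V, w t = u ∧ w (t' + 1) = v ∧ ∀ k, t ≤ k → k ≤ t' → G k (w k) (w (k + 1))

/-- The integral `Ḡ`: `(u,v)` is an edge of `Ḡ(t)` iff it is an edge of `G(t:t')`
for some `t' ≥ t`. -/
def Integral (G : ℕ → V → V → Prop) (t : ℕ) (u v : V) : Prop :=
  ∃ t', t ≤ t' ∧ DProd G t t' u v

/-- The limit superior of a dynamic graph: edges occurring at infinitely many rounds. -/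
def LimSupG (H : ℕ → V → V → Prop) (u v : V) : Prop :=
  ∀ t : ℕ, ∃ t', t ≤ t' ∧ H t' u v

/-- `u` is a central root of the digraph `H`: `(u,v)` is an edge for every `v`. -/
def IsCRoot (H : V → V → Prop) (u : V) : Prop := ∀ v, H u v

/-- `u` is a root of the digraph `H`: every node is reachable from `u` by a path. -/
def IsRoot (H : V → V → Prop) (u : V) : Prop := ∀ v, Relation.ReflTransGen H u v

/-- The kernel of a dynamic graph: `Ker(G) = ∩_{t ≥ 1} CRoots(Ḡ(t))`. -/
def Ker (G : ℕ → V → V → Prop) : Set V :=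
  {u | ∀ t, 1 ≤ t → IsCRoot (Integral G t) u}

/-- `G` is rooted with delay `T`: for every `t ≥ 1` the digraph `G(t : t+T-1)` is rooted. -/
def RootedWithDelay (G : ℕ → V → V → Prop) (T : ℕ) : Prop :=
  ∀ t, 1 ≤ t → ∃ u, IsRoot (fun a b => DProd G t (t + T - 1) a b) u

/-- The active graph `G^a` for start rounds `s`: `(u,v)` is an edge iff `u = v`, or
`(u,v)` is an edge of `G(t)` and both `u` and `v` are active in round `t`. -/
def Ga (G : ℕ → V → V → Prop) (s : V → ℕ) (t : ℕ) (u v : V) : Prop :=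
  u = v ∨ (G t u v ∧ s u ≤ t ∧ s v ≤ t)

lemma dprod_refl (H : ℕ → V → V → Prop) (hH : ∀ t u, H t u u) (t t' : ℕ) (u : V) :
    DProd H t t' u u := by
  unfold DProd
  split
  · rfl
  · exact ⟨fun _ => u, rfl, rfl, fun k _ _ => hH k u⟩

lemma ga_refl (G : ℕ → V → V → Prop) (s : V → ℕ) : ∀ (t : ℕ) (u : V), Ga G s t u u :=
  fun _ u => Or.inl rfl

end DynamicGraphs

/-- With self-loops, the edges of the integral can only disappear over time: a path starting
in round `t` extends to one starting earlier by waiting at its first node. -/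
lemma Integral.antitone {V : Type*} {G : ℕ → V → V → Prop} (hloop : ∀ t u, G t u u) :
    Antitone (Integral G) := by
  rintro s t hst u v ⟨t', ht, h⟩
  rw [DProd, if_neg (by omega)] at h
  obtain ⟨w, hu, hv, hw⟩ := h
  refine ⟨t', hst.trans ht, ?_⟩
  rw [DProd, if_neg (by omega)]
  refine ⟨fun k => if k ≤ t then u else w k, if_pos hst, ?_, fun k _ hk => ?_⟩
  · simpa [show ¬ t' + 1 ≤ t by omega] using hv
  · rcases lt_trichotomy k t with h | rfl | h
    · simpa [h.le, Nat.succ_le_of_lt h] using hloop k u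
    · simpa [← hu] using hw k le_rfl hk
    · simpa [show ¬ k ≤ t by omega, show ¬ k + 1 ≤ t by omega] using hw k h.le hk

/-- A decreasing sequence of digraphs on a finite vertex set eventually equals its limit
superior. -/
lemma Antitone.eventually_iff_limSupG {V : Type*} [Finite V] {H : ℕ → V → V → Prop}
    (hH : Antitone H) : ∀ᶠ t in Filter.atTop, ∀ u v, H t u v ↔ LimSupG H u v := by
  refine Filter.eventually_all.2 fun u => Filter.eventually_all.2 fun v => ?_
  by_cases h : LimSupG H u v
  · refine Filter.Eventually.of_forall fun t => iff_of_true ?_ h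
    obtain ⟨t', ht, h'⟩ := h t
    exact hH ht u v h'
  · have h' := h
    simp only [LimSupG, not_forall, not_exists, not_and] at h'
    obtain ⟨s, hs⟩ := h'
    filter_upwards [Filter.eventually_ge_atTop s] with t ht
    exact iff_of_false (hs t ht) h

/-- the integral of a dynamic graph with permanent self-loops eventually
stabilizes to its limit superior. -/
theorem integral_eventually_stabilizes {V : Type*} [Fintype V] [Nonempty V]
    (G : ℕ → V → V → Prop) (hloop : ∀ t u, G t u u) :
    ∃ s : ℕ, 1 ≤ s ∧ ∀ t, s ≤ t → ∀ u v : V,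
      Integral G t u v ↔ LimSupG (Integral G) u v := by
  obtain ⟨s, hs⟩ := Filter.eventually_atTop.1 (Integral.antitone hloop).eventually_iff_limSupG
  exact ⟨max 1 s, le_max_left _ _, fun t ht => hs t ((le_max_right _ _).trans ht)⟩
end

section
/- Let G be a dynamic graph over a finite nonempty set V, with a self-loop at every node in every round. Then the limit superior of the integral of G equals the transitive closure of the limit superior of G: (u,v) is an edge of Ḡ(∞) if and only if there is a (nonempty) path from u to v in the digraph G(∞). -/
open scoped Classical

/-- A one-edge step can be appended to a product at any later round. -/
lemma DProd.snoc {V : Type*} {G : ℕ → V → V → Prop} (hloop : ∀ t u, G t u u)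
    {t t₁ t₂ : ℕ} {u v c : V} (h₀ : t ≤ t₁) (h₁ : t₁ < t₂) (h : DProd G t t₁ u v)
    (hvc : G t₂ v c) : DProd G t t₂ u c := by
  unfold DProd at h ⊢
  rw [if_neg (by omega)] at h ⊢
  obtain ⟨w, hu, hv, hw⟩ := h
  refine ⟨fun k => if k ≤ t₁ + 1 then w k else if k ≤ t₂ then v else c, ?_, ?_, ?_⟩
  · simp [show t ≤ t₁ + 1 by omega, hu]
  · simp [show ¬ t₂ ≤ t₁ by omega]
  · intro k hk hk'
    rcases lt_trichotomy k (t₁ + 1) with hlt | rfl | hgt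
    · simpa [show k ≤ t₁ + 1 by omega, show k ≤ t₁ by omega] using hw k hk (by omega)
    · rcases eq_or_lt_of_le hk' with heq | hlt
      · simpa [← heq, hv] using heq ▸ hvc
      · simpa [hv, show t₁ + 1 + 1 ≤ t₂ by omega] using hloop (t₁ + 1) v
    · rcases eq_or_lt_of_le hk' with rfl | hlt
      · simpa [show ¬ k ≤ t₁ + 1 by omega, show ¬ k ≤ t₁ by omega] using hvc
      · simpa [show ¬ k ≤ t₁ + 1 by omega, show ¬ k ≤ t₁ by omega, hk',
          show k + 1 ≤ t₂ by omega] using hloop k v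

lemma Integral.snoc {V : Type*} {G : ℕ → V → V → Prop} (hloop : ∀ t u, G t u u)
    {t : ℕ} {u v c : V} (h : Integral G t u v) (hvc : LimSupG G v c) : Integral G t u c := by
  obtain ⟨t₁, h₀, h⟩ := h
  obtain ⟨t₂, h₁, h₂⟩ := hvc (t₁ + 1)
  exact ⟨t₂, by omega, h.snoc hloop h₀ (by omega) h₂⟩

/-- From some round on, only edges of the limit superior occur. -/
lemma exists_forall_ge_limSupG {V : Type*} [Finite V] (G : ℕ → V → V → Prop) :
    ∃ T, ∀ t, T ≤ t → ∀ a b, G t a b → LimSupG G a b := by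
  have h : ∀ᶠ t in Filter.atTop, ∀ a b, G t a b → LimSupG G a b := by
    refine Filter.eventually_all.2 fun a => Filter.eventually_all.2 fun b => ?_
    by_cases hab : LimSupG G a b
    · exact Filter.Eventually.of_forall fun _ _ => hab
    · unfold LimSupG at hab
      push Not at hab
      obtain ⟨T, hT⟩ := hab
      exact Filter.eventually_atTop.2 ⟨T, fun t ht h => absurd h (hT t ht)⟩
  exact Filter.eventually_atTop.1 h

/-- A nonempty product of digraphs contained in `R` is contained in the transitive closure
of `R`. -/
lemma DProd.transGen {V : Type*} {G : ℕ → V → V → Prop} {R : V → V → Prop} {t t' : ℕ} {u v : V}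
    (ht : t ≤ t') (hR : ∀ k, t ≤ k → ∀ a b, G k a b → R a b) (h : DProd G t t' u v) :
    Relation.TransGen R u v := by
  unfold DProd at h
  rw [if_neg (by omega)] at h
  obtain ⟨w, rfl, rfl, hw⟩ := h
  induction t', ht using Nat.le_induction with
  | base => exact .single (hR t le_rfl _ _ (hw t le_rfl le_rfl))
  | succ n hn ih =>
    exact (ih fun k hk hk' => hw k hk (by omega)).tail
      (hR (n + 1) (by omega) _ _ (hw (n + 1) (by omega) le_rfl))

/-- the limit superior of the integral equals the transitive closure of the
limit superior. -/
theorem limsup_integral_eq_transClosure {V : Type*} [Fintype V] [Nonempty V]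
    (G : ℕ → V → V → Prop) (hloop : ∀ t u, G t u u) :
    ∀ u v : V, LimSupG (Integral G) u v ↔ Relation.TransGen (LimSupG G) u v := by
  intro u v
  constructor
  · intro h
    obtain ⟨T, hT⟩ := exists_forall_ge_limSupG G
    obtain ⟨t, ht, t', ht', hp⟩ := h T
    exact hp.transGen ht' fun k hk => hT k (ht.trans hk)
  · intro h t
    refine ⟨t, le_rfl, ?_⟩
    induction h with
    | single h => exact Integral.snoc hloop ⟨t, le_rfl, dprod_refl G hloop t t u⟩ h
    | tail _ h ih => exact ih.snoc hloop h
end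

section
/- Let G be a dynamic graph over a finite nonempty set V, with a self-loop at every node in every round. If G is rooted with delay T for some integer T ≥ 1, then the kernel of G is nonempty: Ker(G) ≠ ∅. -/
open scoped Classical

/-- Concatenation of consecutive products of a dynamic graph. -/
lemma DProd.trans {V : Type*} {G : ℕ → V → V → Prop} {a b c : ℕ} {u v x : V}
    (hab : a ≤ b) (hbc : b < c) (h₁ : DProd G a b u v) (h₂ : DProd G (b + 1) c v x) :
    DProd G a c u x := by
  unfold DProd at *
  rw [if_neg (by omega)] at *
  obtain ⟨p, hpa, hpb, hp⟩ := h₁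
  obtain ⟨q, hqb, hqc, hq⟩ := h₂
  refine ⟨fun k => if k ≤ b then p k else q k, by simp [hab, hpa], ?_, fun k hak hkc => ?_⟩
  · simp [show ¬ c + 1 ≤ b by omega, hqc]
  · rcases lt_trichotomy k b with hk | rfl | hk
    · simpa [hk.le, Nat.succ_le_of_lt hk] using hp k hak hk.le
    · simpa [hqb, ← hpb] using hp k hak le_rfl
    · simpa [show ¬ k ≤ b by omega, show ¬ k + 1 ≤ b by omega] using hq k hk hkc

/-- With self-loops, products are monotone in their last round. -/
lemma DProd.mono_right {V : Type*} {G : ℕ → V → V → Prop} (hloop : ∀ t u, G t u u)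
    {a b c : ℕ} {u v : V} (hab : a ≤ b) (hbc : b ≤ c) (h : DProd G a b u v) :
    DProd G a c u v := by
  rcases hbc.eq_or_lt with rfl | hbc
  · exact h
  · exact h.trans hab hbc (dprod_refl G hloop _ _ _)

/-- A node that is a root of arbitrarily late products lies in the kernel. -/
lemma mem_ker_of_frequently_isRoot {V : Type*} [Fintype V] {G : ℕ → V → V → Prop}
    (hloop : ∀ t u, G t u u) {T : ℕ} (hT : 1 ≤ T) {r : V}
    (hr : ∀ N, ∃ t, N ≤ t ∧ IsRoot (fun a b => DProd G t (t + T - 1) a b) r) :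
    r ∈ Ker G := by
  intro t _ v
  have hex : ∀ x, ∃ s, Integral G t r x → t ≤ s ∧ DProd G t s r x := fun x => by
    by_cases hx : Integral G t r x
    · obtain ⟨s, hs⟩ := hx
      exact ⟨s, fun _ => hs⟩
    · exact ⟨0, fun h => absurd h hx⟩
  choose f hf using hex
  obtain ⟨s, hs, hroot⟩ := hr (t + Finset.univ.sup f + 1)
  obtain ⟨s, rfl⟩ : ∃ m, s = m + 1 := ⟨s - 1, by omega⟩
  induction hroot v with
  | refl => exact ⟨t, le_rfl, dprod_refl G hloop _ _ _⟩
  | @tail a b _ hab ih =>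
    obtain ⟨hta, ha⟩ := hf a ih
    have hfa : f a ≤ Finset.univ.sup f := Finset.le_sup (Finset.mem_univ a)
    exact ⟨s + 1 + T - 1, by omega,
      (ha.mono_right hloop hta (by omega)).trans (by omega) (by omega) hab⟩

/-- a dynamic graph that is rooted with delay `T ≥ 1` has a nonempty kernel. -/
theorem ker_nonempty_of_rootedWithDelay {V : Type*} [Fintype V] [Nonempty V]
    (G : ℕ → V → V → Prop) (hloop : ∀ t u, G t u u)
    (T : ℕ) (hT : 1 ≤ T) (hrooted : RootedWithDelay G T) :
    (Ker G).Nonempty := by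
  suffices h : ∃ r, ∀ N, ∃ t, N ≤ t ∧ IsRoot (fun a b => DProd G t (t + T - 1) a b) r by
    obtain ⟨r, hr⟩ := h
    exact ⟨r, mem_ker_of_frequently_isRoot hloop hT hr⟩
  by_contra! h
  choose N hN using h
  obtain ⟨r, hr⟩ := hrooted (1 + Finset.univ.sup N) (by omega)
  have hNr : N r ≤ Finset.univ.sup N := Finset.le_sup (Finset.mem_univ r)
  exact hN r _ (by omega) hr
end

section
/- Let G be a dynamic graph over a finite nonempty set V, with a self-loop at every node in every round, and suppose Ker(G) = ∅. Then there exist a round s ≥ 1 and two nonempty disjoint subsets U0, U1 of V such that for every u ∈ U0, In_u(s:∞) ∩ U1 = ∅, and for every v ∈ U1, In_v(s:∞) ∩ U0 = ∅; that is, from round s on, no node of U0 can ever be reached from a node of U1 and no node of U1 can ever be reached from a node of U0. -/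
open scoped Classical

theorem integral_refl {V : Type*} {G : ℕ → V → V → Prop} (hloop : ∀ t u, G t u u)
    (t : ℕ) (u : V) : Integral G t u u :=
  ⟨t, le_rfl, dprod_refl G hloop t t u⟩

theorem integral_antitone {V : Type*} {G : ℕ → V → V → Prop} (hloop : ∀ t u, G t u u)
    {t s : ℕ} (hts : t ≤ s) {u v : V} (h : Integral G s u v) : Integral G t u v := by
  obtain ⟨t', ht', h⟩ := h
  rw [DProd, if_neg (by omega)] at h
  obtain ⟨w, hu, hv, hw⟩ := h
  refine ⟨t', hts.trans ht', ?_⟩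
  rw [DProd, if_neg (by omega)]
  refine ⟨fun k => if k ≤ s then u else w k, if_pos hts,
    (if_neg (by omega)).trans hv, fun k _ hk => ?_⟩
  rcases lt_trichotomy k s with hks | rfl | hks
  · simpa [hks.le, Nat.succ_le_iff.mpr hks] using hloop k u
  · simpa [hu] using hw k le_rfl hk
  · simpa [not_le.mpr hks, not_le.mpr (hks.trans k.lt_succ_self)] using hw k hks.le hk

/-- A path found from round `t` on can be continued by paths available arbitrarily late. -/
theorem integral_trans {V : Type*} {G : ℕ → V → V → Prop} {t : ℕ} {u v x : V}
    (huv : Integral G t u v) (hvx : ∀ r, t ≤ r → Integral G r v x) : Integral G t u x := by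
  obtain ⟨t₁, ht₁, h₁⟩ := huv
  obtain ⟨t₂, ht₂, h₂⟩ := hvx (t₁ + 1) (by omega)
  rw [DProd, if_neg (by omega)] at h₁ h₂
  obtain ⟨p, hpu, hpv, hp⟩ := h₁
  obtain ⟨q, hqv, hqx, hq⟩ := h₂
  refine ⟨t₂, by omega, ?_⟩
  rw [DProd, if_neg (by omega)]
  refine ⟨fun k => if k ≤ t₁ then p k else q k, (if_pos ht₁).trans hpu,
    (if_neg (by omega)).trans hqx, fun k hk hk' => ?_⟩
  rcases lt_trichotomy k t₁ with hkt | rfl | hkt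
  · simpa [hkt.le, Nat.succ_le_iff.mpr hkt] using hp k hk hkt.le
  · simpa [hpv, hqv] using hp k hk le_rfl
  · simpa [not_le.mpr hkt, not_le.mpr (hkt.trans k.lt_succ_self)] using hq k hkt hk'

/-- Over a finite set of nodes, the integral of a dynamic graph is eventually constant. -/
theorem exists_integral_stable {V : Type*} [Finite V] {G : ℕ → V → V → Prop}
    (hloop : ∀ t u, G t u u) :
    ∃ s, 1 ≤ s ∧ ∀ u v, Integral G s u v → ∀ t, Integral G t u v := by
  have hex (e : V × V) : ∃ s, Integral G s e.1 e.2 → ∀ t, Integral G t e.1 e.2 := by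
    by_contra! h
    obtain ⟨t, ht⟩ := (h 0).2
    exact ht (h t).1
  choose f hf using hex
  obtain ⟨M, hM⟩ := (Set.finite_range f).bddAbove
  refine ⟨M + 1, by omega, fun u v h => hf (u, v) (integral_antitone hloop ?_ h)⟩
  exact (hM ⟨(u, v), rfl⟩).trans M.le_succ

/-- if the kernel is empty, then from some round `s ≥ 1` on there are two
nonempty disjoint sets of nodes no one of which can ever hear from the other. -/
theorem empty_kernel_gives_separated_sets {V : Type*} [Fintype V] [Nonempty V]
    (G : ℕ → V → V → Prop) (hloop : ∀ t u, G t u u)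
    (hker : Ker G = ∅) :
    ∃ s : ℕ, 1 ≤ s ∧ ∃ U0 U1 : Set V, U0.Nonempty ∧ U1.Nonempty ∧ Disjoint U0 U1 ∧
      (∀ u ∈ U0, ∀ v ∈ U1, ¬ Integral G s v u) ∧
      (∀ v ∈ U1, ∀ u ∈ U0, ¬ Integral G s u v) := by
  obtain ⟨s, hs, hstable⟩ := exists_integral_stable hloop
  let _ : Preorder V :=
    { le := Integral G s
      le_refl := integral_refl hloop s
      le_trans := fun _ _ _ huv hvx => integral_trans huv fun r _ => hstable _ _ hvx r }
  obtain ⟨a, ha⟩ : ∃ a : V, Minimal (fun _ => True) a :=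
    (Set.finite_univ (α := V)).exists_minimal Set.univ_nonempty
  obtain ⟨b, hab⟩ : ∃ b, ¬ Integral G s a b := by
    by_contra! h
    exact Set.eq_empty_iff_forall_notMem.mp hker a fun t _ v => hstable a v (h v) t
  have hba : ¬ Integral G s b a := fun h => hab (ha.2 trivial h)
  have hne : a ≠ b := by
    rintro rfl
    exact hab (integral_refl hloop s a)
  refine ⟨s, hs, {a}, {b}, Set.singleton_nonempty a, Set.singleton_nonempty b,
    Set.disjoint_singleton.mpr hne, ?_, ?_⟩
  · rintro _ rfl _ rfl
    exact hba
  · rintro _ rfl _ rfl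
    exact hab
end

section
/- Let G be a dynamic graph over a finite nonempty set V with a self-loop at every node in every round, with start rounds s_u, input values μ_u in a linearly ordered set 𝒱, cut-off values θ_u(t) with 0 ≤ θ_u(t) ≤ t, and MinMax outputs y_u(t). Assume the cut-offs are safe, and assume there exists a round s ≥ 1 such that for every t ≥ s and every node u, In_u(θ_u(t)+1 : t) ∩ Ker(G) ≠ ∅. Then there exists a round s' such that y_u(t) = m* for every node u and every t ≥ s'; moreover m* = μ_w for some node w. -/
open scoped Classical

section Values

variable {V 𝒱 : Type*} [Fintype V] [LinearOrder 𝒱]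

/-- `m_u(t) = min{μ_v : v ∈ In^a_u(1:t)}`. -/
noncomputable def mVal (G : ℕ → V → V → Prop) (s : V → ℕ) (μ : V → 𝒱) (u : V) (t : ℕ) : 𝒱 :=
  (Finset.univ.filter fun v => DProd (Ga G s) 1 t v u).inf'
    ⟨u, Finset.mem_filter.mpr ⟨Finset.mem_univ u, dprod_refl (Ga G s) (ga_refl G s) 1 t u⟩⟩ μ

/-- `m*_u = min{μ_v : v ∈ In^a_u(1:∞)}`. -/
noncomputable def mStar (G : ℕ → V → V → Prop) (s : V → ℕ) (μ : V → 𝒱) (u : V) : 𝒱 :=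
  (Finset.univ.filter fun v => ∃ t', 1 ≤ t' ∧ DProd (Ga G s) 1 t' v u).inf'
    ⟨u, Finset.mem_filter.mpr ⟨Finset.mem_univ u,
      ⟨1, le_refl 1, dprod_refl (Ga G s) (ga_refl G s) 1 1 u⟩⟩⟩ μ

/-- `m* = max{m*_u : u ∈ V}`. -/
noncomputable def mStarMax [Nonempty V] (G : ℕ → V → V → Prop) (s : V → ℕ) (μ : V → 𝒱) : 𝒱 :=
  Finset.univ.sup' Finset.univ_nonempty (mStar G s μ)

/-- The MinMax output `y_u(t) = max{ m_v(θ_u(t)) : v ∈ In^a_u(θ_u(t)+1 : t) }`. -/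
noncomputable def yVal (G : ℕ → V → V → Prop) (s : V → ℕ) (μ : V → 𝒱) (θ : V → ℕ → ℕ)
    (u : V) (t : ℕ) : 𝒱 :=
  (Finset.univ.filter fun v => DProd (Ga G s) (θ u t + 1) t v u).sup'
    ⟨u, Finset.mem_filter.mpr
      ⟨Finset.mem_univ u, dprod_refl (Ga G s) (ga_refl G s) (θ u t + 1) t u⟩⟩
    (fun v => mVal G s μ v (θ u t))

/-- The cut-offs are safe: `θ_u(t) → ∞` and `t - θ_u(t) → ∞`. -/
def SafeCutoffs (θ : V → ℕ → ℕ) : Prop :=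
  ∀ u : V, Filter.Tendsto (fun t => θ u t) Filter.atTop Filter.atTop ∧
    Filter.Tendsto (fun t => t - θ u t) Filter.atTop Filter.atTop

end Values

section DynamicGraphs

variable {V : Type*} {H : ℕ → V → V → Prop}

lemma dprod_trans {a b c : ℕ} {u v w : V} (hab : a ≤ b) (hbc : b < c)
    (h₁ : DProd H a b u v) (h₂ : DProd H (b + 1) c v w) : DProd H a c u w := by
  rw [DProd, if_neg (by omega)] at h₁ h₂ ⊢
  obtain ⟨p, hpa, hpb, hp⟩ := h₁
  obtain ⟨q, hqb, hqc, hq⟩ := h₂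
  refine ⟨fun k => if k ≤ b then p k else q k, ?_, ?_, fun k hak hkc => ?_⟩
  · simp [hab, hpa]
  · simp [show ¬ c + 1 ≤ b by omega, hqc]
  · rcases lt_trichotomy k b with hk | rfl | hk
    · simpa [hk.le, Nat.succ_le_of_lt hk] using hp k hak hk.le
    · simpa [hqb, hpb] using hp k hak le_rfl
    · simpa [show ¬ k ≤ b by omega, show ¬ k + 1 ≤ b by omega] using hq k hk hkc

lemma dprod_extend (hH : ∀ t u, H t u u) {a b c : ℕ} {u v : V} (hab : a ≤ b) (hbc : b ≤ c)
    (h : DProd H a b u v) : DProd H a c u v := by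
  rcases hbc.eq_or_lt with rfl | hbc
  · exact h
  · exact dprod_trans hab hbc h (dprod_refl H hH _ _ _)

lemma dprod_ga_of_active {G : ℕ → V → V → Prop} {s : V → ℕ} {t t' : ℕ} (ht : ∀ v, s v ≤ t)
    {u v : V} (h : DProd G t t' u v) : DProd (Ga G s) t t' u v := by
  unfold DProd at h ⊢
  split_ifs at h ⊢
  · exact h
  · obtain ⟨w, hw, hw', hG⟩ := h
    exact ⟨w, hw, hw', fun k hk hk' =>
      Or.inr ⟨hG k hk hk', (ht _).trans hk, (ht _).trans hk⟩⟩

end DynamicGraphs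

section Values

variable {V 𝒱 : Type*} [Fintype V] [LinearOrder 𝒱] (G : ℕ → V → V → Prop) (s : V → ℕ) (μ : V → 𝒱)

lemma exists_mStar_eq (u : V) :
    ∃ w t, 1 ≤ t ∧ DProd (Ga G s) 1 t w u ∧ mStar G s μ u = μ w := by
  obtain ⟨w, hw, h⟩ := Finset.exists_mem_eq_inf' (s := Finset.univ.filter fun v =>
    ∃ t', 1 ≤ t' ∧ DProd (Ga G s) 1 t' v u) ⟨u, Finset.mem_filter.mpr ⟨Finset.mem_univ u,
      ⟨1, le_refl 1, dprod_refl (Ga G s) (ga_refl G s) 1 1 u⟩⟩⟩ μ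
  obtain ⟨t, ht, hd⟩ := (Finset.mem_filter.mp hw).2
  exact ⟨w, t, ht, hd, h⟩

variable {G s}

lemma mStar_le {u v : V} {t : ℕ} (ht : 1 ≤ t) (h : DProd (Ga G s) 1 t v u) :
    mStar G s μ u ≤ μ v :=
  Finset.inf'_le _ (Finset.mem_filter.mpr ⟨Finset.mem_univ v, t, ht, h⟩)

lemma mVal_le {u v : V} {t : ℕ} (h : DProd (Ga G s) 1 t v u) : mVal G s μ u t ≤ μ v :=
  Finset.inf'_le _ (Finset.mem_filter.mpr ⟨Finset.mem_univ v, h⟩)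

variable (G s)

lemma eventually_mVal_eq_mStar (u : V) :
    ∀ᶠ t in Filter.atTop, mVal G s μ u t = mStar G s μ u := by
  obtain ⟨w, t₀, ht₀, hd, hw⟩ := exists_mStar_eq G s μ u
  filter_upwards [Filter.eventually_ge_atTop t₀] with t ht
  apply le_antisymm
  · rw [hw]
    exact mVal_le μ (dprod_extend (ga_refl G s) ht₀ ht hd)
  · exact Finset.le_inf' _ _ fun v hv =>
      mStar_le μ (ht₀.trans ht) (Finset.mem_filter.mp hv).2

lemma mStar_le_of_mem_ker {k : V} (hk : k ∈ Ker G) (v : V) :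
    mStar G s μ v ≤ mStar G s μ k := by
  obtain ⟨w, t₀, ht₀, hd, hw⟩ := exists_mStar_eq G s μ k
  obtain ⟨A, hA⟩ := (Set.finite_range s).bddAbove
  have hsA : ∀ x, s x ≤ A := fun x => hA ⟨x, rfl⟩
  obtain ⟨t, ht, hkv⟩ := hk (max t₀ A + 1) (by omega) v
  rw [hw]
  refine mStar_le μ (t := t) (by omega) (dprod_trans (b := max t₀ A) (by omega) (by omega) ?_
    (dprod_ga_of_active (fun x => ?_) hkv))
  · exact dprod_extend (ga_refl G s) ht₀ (le_max_left _ _) hd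
  · have := hsA x
    omega

lemma mStarMax_eq_of_mem_ker [Nonempty V] {k : V} (hk : k ∈ Ker G) :
    mStarMax G s μ = mStar G s μ k :=
  le_antisymm (Finset.sup'_le _ _ fun v _ => mStar_le_of_mem_ker G s μ hk v)
    (Finset.le_sup' _ (Finset.mem_univ k))

end Values

/-- a safe MinMax algorithm stabilizes on `m*` provided every node
eventually always hears from the kernel within its cut-off window; moreover `m*` is
one of the input values. -/
theorem safe_minmax_stabilizes {V 𝒱 : Type*} [Fintype V] [Nonempty V] [LinearOrder 𝒱]
    (G : ℕ → V → V → Prop) (hloop : ∀ t u, G t u u)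
    (s : V → ℕ) (hs : ∀ u, 1 ≤ s u) (μ : V → 𝒱)
    (θ : V → ℕ → ℕ) (hθ : ∀ (u : V) (t : ℕ), 1 ≤ t → θ u t ≤ t)
    (hsafe : SafeCutoffs θ)
    (hker : ∃ s0 : ℕ, 1 ≤ s0 ∧ ∀ t, s0 ≤ t → ∀ u : V,
      ∃ v ∈ Ker G, DProd G (θ u t + 1) t v u) :
    (∃ s' : ℕ, ∀ (u : V) (t : ℕ), s' ≤ t → yVal G s μ θ u t = mStarMax G s μ) ∧
      ∃ w : V, mStarMax G s μ = μ w := by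
  obtain ⟨s₀, -, hker⟩ := hker
  constructor
  · obtain ⟨T, hT⟩ := Filter.eventually_atTop.mp
      (Filter.eventually_all.mpr (eventually_mVal_eq_mStar G s μ))
    obtain ⟨A, hA⟩ := (Set.finite_range s).bddAbove
    obtain ⟨B, hB⟩ := Filter.eventually_atTop.mp (Filter.eventually_all.mpr fun u =>
      (hsafe u).1.eventually_ge_atTop (max T A))
    refine ⟨max s₀ B, fun u t ht => ?_⟩
    have hθt := hB t (le_of_max_le_right ht) u
    have hm := hT (θ u t) (le_of_max_le_left hθt)
    obtain ⟨k, hk, hku⟩ := hker t (le_of_max_le_left ht) u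
    apply le_antisymm
    · refine Finset.sup'_le _ _ fun v _ => ?_
      rw [hm v]
      exact Finset.le_sup' _ (Finset.mem_univ v)
    · have hka : DProd (Ga G s) (θ u t + 1) t k u := dprod_ga_of_active (fun x =>
        (hA ⟨x, rfl⟩).trans ((le_of_max_le_right hθt).trans (Nat.le_succ _))) hku
      rw [mStarMax_eq_of_mem_ker G s μ hk, ← hm k]
      exact Finset.le_sup' (fun v => mVal G s μ v (θ u t))
        (Finset.mem_filter.mpr ⟨Finset.mem_univ k, hka⟩)
  · obtain ⟨u⟩ := ‹Nonempty V›
    obtain ⟨k, hk, -⟩ := hker s₀ le_rfl u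
    obtain ⟨w, -, -, -, hw⟩ := exists_mStar_eq G s μ k
    exact ⟨w, (mStarMax_eq_of_mem_ker G s μ hk).trans hw⟩
end

section
/- Let G be a dynamic graph over a finite nonempty set V with a self-loop at every node in every round, with start rounds s_u, input values μ_u in a linearly ordered set 𝒱, cut-off values θ_u(t) with 0 ≤ θ_u(t) ≤ t, and MinMax outputs y_u(t). Assume the cut-offs are safe and that G is infinitely connected, i.e., Ker(G) = V. Then there exists a round s' such that y_u(t) = m* for every node u and every t ≥ s'; moreover m* = μ_w for some node w. -/
open scoped Classical

section ActivePaths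

variable {V : Type*}

/-- A path of `G` over rounds in which every node is active extends, by waiting at its endpoints,
to a path of the active graph over any larger interval of rounds. -/
lemma dprod_ga_of_dprod {G : ℕ → V → V → Prop} {s : V → ℕ} {a S t' t : ℕ} {u v : V}
    (hS : ∀ x, s x ≤ S) (haS : a ≤ S) (hSt' : S ≤ t') (ht : t' ≤ t) (h : DProd G S t' u v) :
    DProd (Ga G s) a t u v := by
  rw [DProd, if_neg (by omega)] at h ⊢
  obtain ⟨w, hwu, hwv, hw⟩ := h
  refine ⟨fun k => w (max S (min k (t' + 1))), ?_, ?_, fun k _ _ => ?_⟩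
  · exact (congrArg w (by omega)).trans hwu
  · exact (congrArg w (by omega)).trans hwv
  · by_cases hk : S ≤ k ∧ k ≤ t'
    · have h₁ : max S (min k (t' + 1)) = k := by omega
      have h₂ : max S (min (k + 1) (t' + 1)) = k + 1 := by omega
      simp only [h₁, h₂]
      exact Or.inr ⟨hw k hk.1 hk.2, (hS _).trans hk.1, (hS _).trans hk.1⟩
    · exact Or.inl (congrArg w (by omega))

/-- In an infinitely connected dynamic graph, the active products `G^a(1:t)` are eventually
complete. -/
lemma exists_forall_dprod_ga [Finite V] {G : ℕ → V → V → Prop} (s : V → ℕ)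
    (hker : Ker G = Set.univ) :
    ∃ T, 1 ≤ T ∧ ∀ t, T ≤ t → ∀ u v, DProd (Ga G s) 1 t u v := by
  obtain ⟨S, hS⟩ := (Set.finite_range s).bddAbove
  have hreach : ∀ p : V × V, ∃ t', max S 1 ≤ t' ∧ DProd G (max S 1) t' p.1 p.2 := fun p =>
    (hker ▸ Set.mem_univ p.1 : p.1 ∈ Ker G) (max S 1) (le_max_right _ _) p.2
  choose r hr hp using hreach
  obtain ⟨T, hT⟩ := (Set.finite_range r).bddAbove
  refine ⟨max T 1, le_max_right _ _, fun t ht u v => ?_⟩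
  exact dprod_ga_of_dprod (fun x => (hS ⟨x, rfl⟩).trans (le_max_left _ _)) (le_max_right _ _)
    (hr (u, v)) ((hT ⟨(u, v), rfl⟩).trans ((le_max_left _ _).trans ht)) (hp (u, v))

end ActivePaths

/-- a safe MinMax algorithm on an infinitely connected dynamic graph
(`Ker(G) = V`) stabilizes on `m*`, which is one of the input values. -/
theorem safe_minmax_stabilizes_infinitely_connected {V 𝒱 : Type*} [Fintype V] [Nonempty V]
    [LinearOrder 𝒱]
    (G : ℕ → V → V → Prop) (hloop : ∀ t u, G t u u)
    (s : V → ℕ) (hs : ∀ u, 1 ≤ s u) (μ : V → 𝒱)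
    (θ : V → ℕ → ℕ) (hθ : ∀ (u : V) (t : ℕ), 1 ≤ t → θ u t ≤ t)
    (hsafe : SafeCutoffs θ)
    (hker : Ker G = Set.univ) :
    (∃ s' : ℕ, ∀ (u : V) (t : ℕ), s' ≤ t → yVal G s μ θ u t = mStarMax G s μ) ∧
      ∃ w : V, mStarMax G s μ = μ w := by
  obtain ⟨T, hT1, hT⟩ := exists_forall_dprod_ga s hker
  have hm : ∀ u t, T ≤ t → mVal G s μ u t = Finset.univ.inf' Finset.univ_nonempty μ :=
    fun u t ht => Finset.inf'_congr _ (by simp [hT t ht]) fun _ _ => rfl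
  have hmStar : ∀ u, mStar G s μ u = Finset.univ.inf' Finset.univ_nonempty μ := fun u =>
    Finset.inf'_congr _ (Finset.filter_true_of_mem fun v _ => ⟨T, hT1, hT T le_rfl v u⟩)
      fun _ _ => rfl
  have hmax : mStarMax G s μ = Finset.univ.inf' Finset.univ_nonempty μ := by
    simp [mStarMax, funext hmStar]
  constructor
  · obtain ⟨s', hs'⟩ := Filter.eventually_atTop.mp
      (Filter.eventually_all.mpr fun u => (hsafe u).1.eventually_ge_atTop T)
    refine ⟨s', fun u t ht => ?_⟩
    simp only [yVal, hmax, hm _ _ (hs' t ht u)]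
    exact Finset.sup'_const _ _
  · obtain ⟨w, -, hw⟩ := Finset.exists_mem_eq_inf' Finset.univ_nonempty μ
    exact ⟨w, hmax.trans hw⟩
end

section
/- Let V be a finite set with at least 2 elements. Suppose Θ assigns to each node u, each round t ≥ 1, and each dynamic graph G over V (with a self-loop at every node in every round) a natural number Θ(u,t,G) such that: (i) 0 ≤ Θ(u,t,G) ≤ t; (ii) Θ is prefix-local: if two such dynamic graphs G and G' satisfy G(k) = G'(k) for every k ≤ t, then Θ(u,t,G) = Θ(u,t,G'); (iii) Θ is safe: for every such dynamic graph G and every node u, Θ(u,t,G) → ∞ and t − Θ(u,t,G) → ∞ as t → ∞. Then there exist a dynamic graph G over V with a self-loop at every node in every round and with Ker(G) ≠ ∅, and input values μ_u ∈ {0,1}, such that, taking all start rounds equal to 1 and cut-offs θ_u(t) = Θ(u,t,G), the MinMax outputs y_u(t) violate eventual agreement: there is no round s such that y_v(t) = y_u(s) for all nodes u, v and all t ≥ s. -/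
open scoped Classical

/-- A node with no incoming edge from another node throughout an interval of rounds is its
own only in-neighbor in the product over that interval. -/
theorem DProd.eq_of_isolated {V : Type*} {G : ℕ → V → V → Prop} {t t' : ℕ} {u v : V}
    (hG : ∀ k x, t ≤ k → k ≤ t' → G k x v → x = v) (h : DProd G t t' u v) : u = v := by
  unfold DProd at h
  split_ifs at h with hlt
  · exact h
  · obtain ⟨w, rfl, hv, hw⟩ := h
    refine Nat.decreasingInduction' (P := fun k => w k = v) (fun k hk htk ih => ?_)
      (by omega : t ≤ t' + 1) hv
    have hedge := hw k htk (by omega)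
    rw [ih] at hedge
    exact hG k _ htk (by omega) hedge

/-- If all in-neighbors of `u` in the window that starts after the cut-off are `u` itself, then
the output of `u` is its own minimum at the cut-off. -/
theorem yVal_eq_mVal_of_isolated {V 𝒱 : Type*} [Fintype V] [LinearOrder 𝒱]
    {G : ℕ → V → V → Prop} {s : V → ℕ} {μ : V → 𝒱} {θ : V → ℕ → ℕ} {u : V} {t : ℕ}
    (hG : ∀ k x, θ u t + 1 ≤ k → k ≤ t → G k x u → x = u) :
    yVal G s μ θ u t = mVal G s μ u (θ u t) := by
  have hGa : ∀ k x, θ u t + 1 ≤ k → k ≤ t → Ga G s k x u → x = u := by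
    rintro k x h₁ h₂ (h | h)
    exacts [h, hG k x h₁ h₂ h.1]
  apply le_antisymm
  · refine Finset.sup'_le _ _ fun v hv => ?_
    rw [DProd.eq_of_isolated hGa (Finset.mem_filter.mp hv).2]
  · have hu : u ∈ Finset.univ.filter fun v => DProd (Ga G s) (θ u t + 1) t v u :=
      Finset.mem_filter.mpr ⟨Finset.mem_univ u, dprod_refl _ (ga_refl G s) _ _ u⟩
    exact Finset.le_sup' (fun v => mVal G s μ v (θ u t)) hu

theorem mVal_le_self {V 𝒱 : Type*} [Fintype V] [LinearOrder 𝒱]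
    (G : ℕ → V → V → Prop) (s : V → ℕ) (μ : V → 𝒱) (u : V) (t : ℕ) : mVal G s μ u t ≤ μ u := by
  have hu : u ∈ Finset.univ.filter fun v => DProd (Ga G s) 1 t v u :=
    Finset.mem_filter.mpr ⟨Finset.mem_univ u, dprod_refl _ (ga_refl G s) _ _ u⟩
  exact Finset.inf'_le μ hu

theorem mVal_eq_of_isolated {V 𝒱 : Type*} [Fintype V] [LinearOrder 𝒱]
    {G : ℕ → V → V → Prop} {s : V → ℕ} {μ : V → 𝒱} {u : V} {t : ℕ}
    (hG : ∀ k x, G k x u → x = u) : mVal G s μ u t = μ u := by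
  refine le_antisymm (mVal_le_self G s μ u t) (Finset.le_inf' _ _ fun v hv => ?_)
  have hvu : v = u := DProd.eq_of_isolated
    (fun k x _ _ h => h.elim id fun h => hG k x h.1) (Finset.mem_filter.mp hv).2
  rw [hvu]

/-- The dynamic graph in which, besides self-loops, `a` sends to all nodes exactly in the
rounds of `B`. -/
def broadcastGraph {V : Type*} (a : V) (B : Set ℕ) (t : ℕ) (u v : V) : Prop :=
  u = v ∨ (u = a ∧ t ∈ B)

theorem mem_ker_broadcastGraph {V : Type*} (a : V) {B : Set ℕ}
    (hB : ∀ N, ∃ t, N ≤ t ∧ t ∈ B) : a ∈ Ker (broadcastGraph a B) := by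
  intro t _ v
  obtain ⟨r, htr, hr⟩ := hB t
  refine ⟨r, htr, ?_⟩
  unfold DProd
  rw [if_neg (by omega)]
  refine ⟨fun k => if k ≤ r then a else v, by simp [htr], by simp, fun k _ hk => ?_⟩
  rcases hk.eq_or_lt with rfl | hlt
  · exact Or.inr ⟨by simp, hr⟩
  · exact Or.inl (by simp [hk, Nat.succ_le_of_lt hlt])

/-- A set of natural numbers whose successors are decided by a predicate on what lies below. -/
def adaptiveSet (P : ℕ → Set ℕ → Prop) : ℕ → Prop
  | 0 => False
  | t + 1 => P t {x | ∃ _ : x < t + 1, adaptiveSet P x}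

theorem exists_set_succ_mem_iff (P : ℕ → Set ℕ → Prop) :
    ∃ B : Set ℕ, ∀ t, t + 1 ∈ B ↔ P t {x | x ≤ t ∧ x ∈ B} := by
  refine ⟨{x | adaptiveSet P x}, fun t => ?_⟩
  rw [Set.mem_ofPred_eq, adaptiveSet]
  simp only [Set.mem_ofPred_eq, exists_prop, Nat.lt_succ_iff]

/-- no safe (prefix-local) MinMax algorithm achieves eventual agreement on
all dynamic graphs with nonempty kernels. -/
theorem no_safe_minmax_on_nonempty_kernels {V : Type*} [Fintype V]
    (hcard : 2 ≤ Fintype.card V)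
    (Θ : V → ℕ → (ℕ → V → V → Prop) → ℕ)
    (hbound : ∀ (u : V) (t : ℕ) (G : ℕ → V → V → Prop),
      (∀ t u, G t u u) → 1 ≤ t → Θ u t G ≤ t)
    (hlocal : ∀ (u : V) (t : ℕ) (G G' : ℕ → V → V → Prop),
      (∀ t u, G t u u) → (∀ t u, G' t u u) →
      (∀ k, k ≤ t → G k = G' k) → Θ u t G = Θ u t G')
    (hsafe : ∀ G : ℕ → V → V → Prop, (∀ t u, G t u u) →
      SafeCutoffs (fun u t => Θ u t G)) :
    ∃ (G : ℕ → V → V → Prop) (μ : V → ℕ),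
      (∀ t u, G t u u) ∧ (Ker G).Nonempty ∧ (∀ u, μ u = 0 ∨ μ u = 1) ∧
      ¬ ∃ s : ℕ, ∀ (u v : V) (t : ℕ), s ≤ t →
        yVal G (fun _ => 1) μ (fun u t => Θ u t G) v t
          = yVal G (fun _ => 1) μ (fun u t => Θ u t G) u s := by
  have : Nontrivial V := Fintype.one_lt_card_iff_nontrivial.mp hcard
  obtain ⟨a, b, hab⟩ := exists_pair_ne V
  have hrefl : ∀ B t u, broadcastGraph (V := V) a B t u u := fun _ _ _ => Or.inl rfl
  obtain ⟨B, hB⟩ := exists_set_succ_mem_iff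
    fun t S => ∀ x ∈ S, x ≤ Θ b t (broadcastGraph a S)
  have hcut : ∀ t, Θ b t (broadcastGraph a {x | x ≤ t ∧ x ∈ B}) = Θ b t (broadcastGraph a B) :=
    fun t => hlocal b t _ _ (hrefl _) (hrefl _) fun k hk => by
      funext u v
      simp [broadcastGraph, hk]
  have hmem : ∀ t, t + 1 ∈ B ↔ ∀ x ∈ B, x ≤ t → x ≤ Θ b t (broadcastGraph a B) := by
    intro t
    rw [hB t, hcut t]
    exact ⟨fun h x hx hxt => h x ⟨hxt, hx⟩, fun h x hx => h x hx.2 hx.1⟩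
  have hinf : ∀ N, ∃ t, N ≤ t ∧ t + 1 ∈ B := by
    intro N
    by_contra! hfin
    obtain ⟨t, hΘ, hNt⟩ := ((hsafe _ (hrefl B) b).1.eventually_ge_atTop N |>.and
      (Filter.eventually_ge_atTop N)).exists
    refine hfin t hNt ((hmem t).2 fun x hx _ => le_trans ?_ hΘ)
    by_contra! hNx
    obtain ⟨y, rfl⟩ := Nat.exists_eq_succ_of_ne_zero (by omega : x ≠ 0)
    exact hfin y (by omega) hx
  refine ⟨broadcastGraph a B, fun u => if u = a then 1 else 0, hrefl B,
    ⟨a, mem_ker_broadcastGraph a fun N => ?_⟩, fun u => ?_, ?_⟩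
  · obtain ⟨t, ht, htB⟩ := hinf N
    exact ⟨t + 1, by omega, htB⟩
  · by_cases h : u = a <;> simp [h]
  · rintro ⟨s, hs⟩
    obtain ⟨t, hst, ht⟩ := hinf s
    have hiso : ∀ k x, broadcastGraph a B k x a → x = a := fun k x h => h.elim id And.left
    have heq := (hs a a t hst).trans (hs a b t hst).symm
    rw [yVal_eq_mVal_of_isolated fun k x _ _ => hiso k x, mVal_eq_of_isolated hiso,
      yVal_eq_mVal_of_isolated (u := b)] at heq
    · have hle := mVal_le_self (broadcastGraph a B) (fun _ => 1)
        (fun u => if u = a then 1 else 0) b (Θ b t (broadcastGraph a B))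
      rw [← heq, if_pos rfl, if_neg hab.symm] at hle
      omega
    · rintro k x hk hkt (h | ⟨-, hkB⟩)
      · exact h
      · have := (hmem t).1 ht k hkB hkt
        omega
end

section
/- Let H be a rooted digraph on a finite nonempty set V of cardinality n, with a self-loop at every node, and let G be the constant dynamic graph defined by G(t) = H for every round t ≥ 1. Take all start rounds equal to 1, input values μ_u in a linearly ordered set 𝒱, and cut-offs θ_u(t) = ⌊t/2⌋. Then the MinMax outputs converge within 2n rounds: for every node u and every round t ≥ 2n, y_u(t) = m*. -/
open scoped Classical

section Reachability

variable {V : Type*}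

lemma dprod_succ {G : ℕ → V → V → Prop} {t t' : ℕ} (h : t ≤ t' + 1) {u v : V} :
    DProd G t (t' + 1) u v ↔ ∃ x, DProd G t t' u x ∧ G (t' + 1) x v := by
  unfold DProd
  rw [if_neg (by omega)]
  split_ifs with hlt
  · obtain rfl : t = t' + 1 := by omega
    constructor
    · rintro ⟨w, rfl, rfl, hw⟩
      exact ⟨_, rfl, hw _ le_rfl le_rfl⟩
    · rintro ⟨_, rfl, hv⟩
      refine ⟨fun k => if k ≤ t' + 1 then u else v, by simp, by simp, fun k h₁ h₂ => ?_⟩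
      obtain rfl : k = t' + 1 := by omega
      simpa using hv
  · constructor
    · rintro ⟨w, hu, rfl, hw⟩
      exact ⟨w (t' + 1), ⟨w, hu, rfl, fun k h₁ h₂ => hw k h₁ (by omega)⟩, hw _ h le_rfl⟩
    · rintro ⟨x, ⟨w, hu, rfl, hw⟩, hv⟩
      refine ⟨Function.update w (t' + 2) v, ?_, by simp, fun k h₁ h₂ => ?_⟩
      · rwa [Function.update_of_ne (by omega)]
      · rw [Function.update_of_ne (by omega)]
        rcases Nat.lt_or_ge k (t' + 1) with hk | hk
        · rw [Function.update_of_ne (by omega)]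
          exact hw k h₁ (by omega)
        · obtain rfl : k = t' + 1 := by omega
          simpa using hv

lemma reflTransGen_of_dprod {H : V → V → Prop} {s k : ℕ} {u v : V}
    (h : DProd (fun _ => H) (s + 1) (s + k) u v) : Relation.ReflTransGen H u v := by
  induction k generalizing v with
  | zero =>
    obtain rfl : u = v := by simpa [DProd] using h
    exact .refl
  | succ k ih =>
    obtain ⟨x, hx, hv⟩ := (dprod_succ (t' := s + k) (by omega)).1 h
    exact (ih hx).tail hv

/-- The set of nodes reached in `k` rounds either has more than `k` elements or is closed. -/
lemma lt_card_or_closed [Fintype V] {H : V → V → Prop} (hself : ∀ u, H u u) (s k : ℕ) (u : V) :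
    k < (Finset.univ.filter fun v => DProd (fun _ => H) (s + 1) (s + k) u v).card ∨
      ∀ a b, DProd (fun _ => H) (s + 1) (s + k) u a → H a b →
        DProd (fun _ => H) (s + 1) (s + k) u b := by
  have hstep : ∀ k v, DProd (fun _ => H) (s + 1) (s + (k + 1)) u v ↔
      ∃ x, DProd (fun _ => H) (s + 1) (s + k) u x ∧ H x v :=
    fun k v => dprod_succ (t' := s + k) (by omega)
  induction k with
  | zero =>
    exact .inl (Finset.card_pos.2
      ⟨u, Finset.mem_filter.2 ⟨Finset.mem_univ u, dprod_refl _ (fun _ => hself) _ _ u⟩⟩)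
  | succ k ih =>
    by_cases hcl : ∀ a b, DProd (fun _ => H) (s + 1) (s + k) u a → H a b →
        DProd (fun _ => H) (s + 1) (s + k) u b
    · right
      intro a b ha hab
      obtain ⟨x, hx, hxa⟩ := (hstep k a).1 ha
      exact (hstep k b).2 ⟨a, hcl x a hx hxa, hab⟩
    · left
      refine lt_of_le_of_lt (Nat.succ_le_of_lt (ih.resolve_right hcl)) (Finset.card_lt_card ?_)
      push Not at hcl
      obtain ⟨a, b, ha, hab, hb⟩ := hcl
      rw [Finset.ssubset_iff_of_subset]
      · exact ⟨b, by simpa using (hstep k b).2 ⟨a, ha, hab⟩, by simpa using hb⟩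
      · intro v hv
        rw [Finset.mem_filter] at hv ⊢
        exact ⟨hv.1, (hstep k v).2 ⟨v, hv.2, hself v⟩⟩

lemma dprod_iff_reflTransGen [Fintype V] {H : V → V → Prop} (hself : ∀ u, H u u) {s k : ℕ}
    (hk : Fintype.card V ≤ k) {u v : V} :
    DProd (fun _ => H) (s + 1) (s + k) u v ↔ Relation.ReflTransGen H u v := by
  refine ⟨reflTransGen_of_dprod, fun h => ?_⟩
  have hcl := (lt_card_or_closed hself s k u).resolve_left
    (not_lt.2 ((Finset.card_le_univ _).trans hk))
  induction h with
  | refl => exact dprod_refl _ (fun _ => hself) _ _ u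
  | tail _ hbc ih => exact hcl _ _ ih hbc

lemma dprod_congr {G G' : ℕ → V → V → Prop} {t t' : ℕ} (h : ∀ k, t ≤ k → G k = G' k) (u v : V) :
    DProd G t t' u v ↔ DProd G' t t' u v := by
  unfold DProd
  split_ifs
  · rfl
  · refine exists_congr fun w => and_congr_right fun _ => and_congr_right fun _ =>
      forall_congr' fun k => forall_congr' fun hk => ?_
    rw [h k hk]

lemma dprod_ga_const {H : V → V → Prop} (hself : ∀ u, H u u) (s t : ℕ) (u v : V) :
    DProd (Ga (fun _ => H) fun _ => 1) (s + 1) t u v ↔ DProd (fun _ => H) (s + 1) t u v := by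
  refine dprod_congr (fun k hk => ?_) u v
  funext a b
  refine propext ⟨?_, fun h => .inr ⟨h, le_of_add_le_right hk, le_of_add_le_right hk⟩⟩
  rintro (rfl | h)
  exacts [hself a, h.1]

lemma dprod_ga_const_iff_reflTransGen [Fintype V] {H : V → V → Prop} (hself : ∀ u, H u u)
    {s t : ℕ} (ht : s + Fintype.card V ≤ t) {u v : V} :
    DProd (Ga (fun _ => H) fun _ => 1) (s + 1) t u v ↔ Relation.ReflTransGen H u v := by
  obtain ⟨k, rfl⟩ := Nat.exists_eq_add_of_le (le_of_add_le_left ht)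
  rw [dprod_ga_const hself, dprod_iff_reflTransGen hself (by omega)]

end Reachability

section Limits

variable {V 𝒱 : Type*} [Fintype V] [LinearOrder 𝒱]

lemma mem_limit_inNeighbors_iff {H : V → V → Prop} (hself : ∀ u, H u u) {u v : V} :
    (∃ t', 1 ≤ t' ∧ DProd (Ga (fun _ => H) fun _ => 1) 1 t' v u) ↔
      Relation.ReflTransGen H v u := by
  constructor
  · rintro ⟨t', -, h⟩
    refine reflTransGen_of_dprod (s := 0) (k := t') ?_
    rw [Nat.zero_add]
    rwa [zero_add, ← dprod_ga_const hself]
  · intro h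
    have : Nonempty V := ⟨u⟩
    exact ⟨Fintype.card V, Fintype.card_pos,
      (dprod_ga_const_iff_reflTransGen hself (s := 0) (by omega)).2 h⟩

lemma mVal_eq_mStar {H : V → V → Prop} (hself : ∀ u, H u u) (μ : V → 𝒱) {t : ℕ}
    (ht : Fintype.card V ≤ t) (u : V) :
    mVal (fun _ => H) (fun _ => 1) μ u t = mStar (fun _ => H) (fun _ => 1) μ u := by
  unfold mVal mStar
  congr 1
  refine Finset.filter_congr fun v _ => ?_
  rw [mem_limit_inNeighbors_iff hself]
  exact dprod_ga_const_iff_reflTransGen hself (s := 0) (by omega)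

lemma mStar_antitone {H : V → V → Prop} (hself : ∀ u, H u u) (μ : V → 𝒱) {u v : V}
    (h : Relation.ReflTransGen H u v) :
    mStar (fun _ => H) (fun _ => 1) μ v ≤ mStar (fun _ => H) (fun _ => 1) μ u := by
  refine Finset.inf'_mono μ (fun w hw => ?_) _
  rw [Finset.mem_filter, mem_limit_inNeighbors_iff hself] at hw ⊢
  exact ⟨hw.1, hw.2.trans h⟩

end Limits

/-- on a fixed rooted digraph with self-loops, with all starts at round 1
and cut-offs `θ_u(t) = ⌊t/2⌋`, the MinMax outputs equal `m*` from round `2n` on. -/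
theorem minmax_fixed_rooted_converges {V 𝒱 : Type*} [Fintype V] [Nonempty V]
    [LinearOrder 𝒱]
    (H : V → V → Prop) (hself : ∀ u, H u u) (hroot : ∃ u, IsRoot H u)
    (μ : V → 𝒱) :
    ∀ (u : V) (t : ℕ), 2 * Fintype.card V ≤ t →
      yVal (fun _ => H) (fun _ => 1) μ (fun _ t => t / 2) u t
        = mStarMax (fun _ => H) (fun _ => 1) μ := by
  intro u t ht
  obtain ⟨r, hr⟩ := hroot
  have hm : ∀ v, mVal (fun _ => H) (fun _ => 1) μ v (t / 2) =
      mStar (fun _ => H) (fun _ => 1) μ v :=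
    mVal_eq_mStar hself μ (by omega)
  apply le_antisymm
  · refine Finset.sup'_le _ _ fun v _ => ?_
    rw [hm v]
    exact Finset.le_sup' _ (Finset.mem_univ v)
  · refine Finset.sup'_le _ _ fun v _ => (mStar_antitone hself μ (hr v)).trans ?_
    rw [← hm r]
    refine (Finset.le_sup'_iff _).2 ⟨r, Finset.mem_filter.2 ⟨Finset.mem_univ r, ?_⟩, le_rfl⟩
    exact (dprod_ga_const_iff_reflTransGen hself (by dsimp only; omega)).2 (hr u)
end

section
/- Every non-split digraph on a finite nonempty set V is rooted: if H is a digraph on V such that any two nodes of V have a common in-neighbor in H, then H has a root, i.e., a node from which every node of V is reachable by a path in H. -/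
open scoped Classical

/-- every non-split digraph on a finite nonempty set is rooted. -/
theorem nonsplit_is_rooted {V : Type*} [Fintype V] [Nonempty V]
    (H : V → V → Prop) (hns : ∀ u v : V, ∃ w : V, H w u ∧ H w v) :
    ∃ u : V, IsRoot H u := by
  have hdir : Directed (fun a b => Relation.ReflTransGen H b a) (id : V → V) := fun u v =>
    let ⟨w, hu, hv⟩ := hns u v
    ⟨w, .single hu, .single hv⟩
  have : IsTrans V (fun a b => Relation.ReflTransGen H b a) := ⟨fun _ _ _ hab hbc => hbc.trans hab⟩
  exact hdir.finite_le id
end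

section
/- Let G be a dynamic graph over a finite nonempty set V with a self-loop at every node in every round, with start rounds s_u and input values μ_u in a linearly ordered set 𝒱. If G is infinitely connected, i.e., Ker(G) = V, then there exists a round t0 such that for every t ≥ t0 and every node u, m_u(t) = min{μ_v : v ∈ V}; in particular all the values m_u(t) stabilize to the global minimum of the inputs. -/
open scoped Classical

/-- Once every node is active, a path of `G` is a path of the active graph, and it can be
extended at both ends by self-loops. -/
lemma dprod_ga_of_dprod_s18 {V : Type*} {G : ℕ → V → V → Prop} {s : V → ℕ} {a b a' b' : ℕ} {u v : V}
    (hs : ∀ x, s x ≤ a) (ha : a' ≤ a) (hab : a ≤ b) (hb : b ≤ b') (h : DProd G a b u v) :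
    DProd (Ga G s) a' b' u v := by
  rw [DProd, if_neg (by omega)] at h ⊢
  obtain ⟨w, hu, hv, hw⟩ := h
  refine ⟨fun k => w (min (max k a) (b + 1)), ?_, ?_, fun k _ _ => ?_⟩
  · simpa only [show min (max a' a) (b + 1) = a by omega] using hu
  · simpa only [show min (max (b' + 1) a) (b + 1) = b + 1 by omega] using hv
  · beta_reduce
    by_cases hk : a ≤ k ∧ k ≤ b
    · rw [show min (max k a) (b + 1) = k by omega,
        show min (max (k + 1) a) (b + 1) = k + 1 by omega]
      exact Or.inr ⟨hw k hk.1 hk.2, (hs _).trans hk.1, (hs _).trans hk.1⟩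
    · rw [show min (max (k + 1) a) (b + 1) = min (max k a) (b + 1) by omega]
      exact ga_refl G s k _

/-- on an infinitely connected dynamic graph the values `m_u(t)` stabilize
to the global minimum of the inputs. -/
theorem min_algorithm_infinitely_connected {V 𝒱 : Type*} [Fintype V] [Nonempty V]
    [LinearOrder 𝒱]
    (G : ℕ → V → V → Prop) (hloop : ∀ t u, G t u u)
    (s : V → ℕ) (hs : ∀ u, 1 ≤ s u) (μ : V → 𝒱)
    (hker : Ker G = Set.univ) :
    ∃ t0 : ℕ, ∀ t, t0 ≤ t → ∀ u : V,
      mVal G s μ u t = Finset.univ.inf' Finset.univ_nonempty μ := by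
  have hle : ∀ x, s x ≤ Finset.univ.sup s := fun x => Finset.le_sup (Finset.mem_univ x)
  have hone : 1 ≤ Finset.univ.sup s := (hs _).trans (hle (Classical.arbitrary V))
  have hint : ∀ p : V × V, Integral G (Finset.univ.sup s) p.1 p.2 := fun p =>
    (hker ▸ Set.mem_univ p.1 : p.1 ∈ Ker G) _ hone p.2
  choose τ hτ hpath using hint
  refine ⟨Finset.univ.sup τ, fun t ht u => ?_⟩
  refine Finset.inf'_congr _ (Finset.filter_true_of_mem fun v _ => ?_) fun _ _ => rfl
  exact dprod_ga_of_dprod_s18 hle hone (hτ (v, u))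
    ((Finset.le_sup (Finset.mem_univ (v, u))).trans ht) (hpath (v, u))
end
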